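/- arXiv:2603.16833 — 2 statements merged into one kernel-verified Lean document; each statement's English description precedes it below -/
import Mathlib

section
/- Nested identification of the arm-1 counterfactual mean (Theorem 1, single-arm weighted form): under consistency, ignorability, surrogate-mediated MAR, treatment positivity, and censoring support positivity, E[(A / e) · Q̄] = E[Y(1)]; that is, integrating the observed-data outcome regression over the conditional intermediate distribution in the treated arm recovers E[Y(1)] without any inverse censoring weight. -/
open MeasureTheory ProbabilityTheory

/-- A conditionally independent pair has multiplicative conditional expectation. -/
theorem condExp_mul_of_condIndepFun {Ω : Type*} {m mΩ : MeasurableSpace Ω} [StandardBorelSpace Ω]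
    {μ : Measure Ω} [IsFiniteMeasure μ] {X Z : Ω → ℝ} (hm : m ≤ mΩ)
    (hX : Measurable X) (hZ : Measurable Z) (hindep : CondIndepFun m hm X Z μ)
    (hXint : Integrable X μ) (hZint : Integrable Z μ)
    (hXZint : Integrable (fun ω ↦ X ω * Z ω) μ) :
    μ[fun ω ↦ X ω * Z ω | m] =ᵐ[μ] fun ω ↦ (μ[X | m]) ω * (μ[Z | m]) ω := by
  have hprod := ae_of_ae_trim hm ((condIndepFun_iff_map_prod_eq_prod_map_map hX hZ).1 hindep)
  filter_upwards [hprod, condExp_ae_eq_integral_condExpKernel hm hXint,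
    condExp_ae_eq_integral_condExpKernel hm hZint,
    condExp_ae_eq_integral_condExpKernel hm hXZint] with ω hω hXω hZω hXZω
  rw [hXω, hZω, hXZω]
  refine IndepFun.integral_fun_mul_eq_mul_integral ?_ hX.aestronglyMeasurable
    hZ.aestronglyMeasurable
  rw [indepFun_iff_map_prod_eq_prod_map_map hX.aemeasurable hZ.aemeasurable]
  rwa [Kernel.map_apply _ (hX.prodMk hZ), Kernel.prod_apply, Kernel.map_apply _ hX,
    Kernel.map_apply _ hZ] at hω

/-- Weighting by a bounded `m`-measurable function, an integrable function may be replaced by its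
conditional expectation given `m` under the integral. -/
theorem integral_mul_condExp_of_bound {Ω : Type*} {m mΩ : MeasurableSpace Ω}
    {μ : Measure Ω} [IsFiniteMeasure μ] {f g : Ω → ℝ} (hm : m ≤ mΩ)
    (hf : StronglyMeasurable[m] f) (hg : Integrable g μ) (c : ℝ)
    (hf_bound : ∀ᵐ ω ∂μ, ‖f ω‖ ≤ c) :
    ∫ ω, f ω * (μ[g | m]) ω ∂μ = ∫ ω, f ω * g ω ∂μ :=
  (integral_congr_ae (condExp_stronglyMeasurable_mul_of_bound hm hf hg c hf_bound)).symm.trans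
    (integral_condExp hm)

/-- **Nested identification of the arm-1 counterfactual mean** (Theorem 1, single-arm
weighted form).  With `𝔪 := σ(S, A, W)`, `𝔴 := σ(W)`, `gΔ` a version of `E[Δ | 𝔪]`,
`e` a version of `E[A | 𝔴]`, and the observed-data outcome regression
`Q̄ := E[Δ·Y | 𝔪] / gΔ`, under consistency, ignorability, surrogate-mediated MAR,
treatment positivity and censoring support positivity one has
`E[(A / e) · Q̄] = E[Y(1)]` — no inverse censoring weight appears. -/
theorem nested_identification_arm1
    {Ω : Type*} [mΩ : MeasurableSpace Ω] [StandardBorelSpace Ω]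
    {P : Measure Ω} [IsProbabilityMeasure P] {p : ℕ}
    (W : Ω → (Fin p → ℝ)) (A S Δ Y Y0 Y1 : Ω → ℝ)
    (hW : Measurable W) (hA : Measurable A) (hS : Measurable S)
    (hΔ : Measurable Δ) (hY : Measurable Y)
    (hY0 : Measurable Y0) (hY1 : Measurable Y1)
    (hA01 : ∀ ω, A ω = 0 ∨ A ω = 1) (hΔ01 : ∀ ω, Δ ω = 0 ∨ Δ ω = 1)
    (𝔪 𝔴 : MeasurableSpace Ω)
    (h𝔪 : 𝔪 = MeasurableSpace.comap (fun ω => (S ω, A ω, W ω)) inferInstance)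
    (h𝔴 : 𝔴 = MeasurableSpace.comap W inferInstance)
    (h𝔪le : 𝔪 ≤ mΩ) (h𝔴le : 𝔴 ≤ mΩ)
    -- consistency
    (hcons : ∀ ω, Y ω = A ω * Y1 ω + (1 - A ω) * Y0 ω)
    -- ignorability
    (hign : CondIndepFun 𝔴 h𝔴le A (fun ω => (Y0 ω, Y1 ω)) P)
    -- surrogate-mediated MAR
    (hMAR : CondIndepFun 𝔪 h𝔪le Δ Y P)
    (hY0int : Integrable Y0 P) (hY1int : Integrable Y1 P) (hYint : Integrable Y P)
    (gΔ : Ω → ℝ) (hgΔ : gΔ =ᵐ[P] P[Δ | 𝔪])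
    (e : Ω → ℝ) (he : e =ᵐ[P] P[A | 𝔴])
    -- treatment positivity
    (cA : ℝ) (hcA : 0 < cA) (hepos : ∀ᵐ ω ∂P, cA ≤ e ω ∧ e ω ≤ 1 - cA)
    -- censoring support positivity
    (cΔ : ℝ) (hcΔ : 0 < cΔ) (hgΔpos : ∀ᵐ ω ∂P, cΔ ≤ gΔ ω) :
    ∫ ω, (A ω / e ω) * ((P[fun ω' => Δ ω' * Y ω' | 𝔪]) ω / gΔ ω) ∂P
      = ∫ ω, Y1 ω ∂P := by
  have h𝔴𝔪 : 𝔴 ≤ 𝔪 := by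
    rw [h𝔴, h𝔪]
    exact ((measurable_snd.comp measurable_snd).comp
      (comap_measurable fun ω ↦ (S ω, A ω, W ω))).comap_le
  have hA𝔪 : Measurable[𝔪] A := by
    rw [h𝔪]
    exact (measurable_fst.comp measurable_snd).comp
      (comap_measurable fun ω ↦ (S ω, A ω, W ω))
  have hAbound : ∀ ω, ‖A ω‖ ≤ 1 := fun ω ↦ by rcases hA01 ω with h | h <;> simp [h]
  have hΔbound : ∀ ω, ‖Δ ω‖ ≤ 1 := fun ω ↦ by rcases hΔ01 ω with h | h <;> simp [h]
  have hAint : Integrable A P := .of_bound hA.aestronglyMeasurable 1 (ae_of_all _ hAbound)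
  have hΔint : Integrable Δ P := .of_bound hΔ.aestronglyMeasurable 1 (ae_of_all _ hΔbound)
  have hΔYint : Integrable (fun ω ↦ Δ ω * Y ω) P :=
    hYint.bdd_mul hΔ.aestronglyMeasurable (ae_of_all _ hΔbound)
  have hAY1int : Integrable (fun ω ↦ A ω * Y1 ω) P :=
    hY1int.bdd_mul hA.aestronglyMeasurable (ae_of_all _ hAbound)
  have hMARmul := condExp_mul_of_condIndepFun h𝔪le hΔ hY hMAR hΔint hYint hΔYint
  have hAY1 : CondIndepFun 𝔴 h𝔴le A Y1 P := hign.comp measurable_id measurable_snd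
  have hignmul := condExp_mul_of_condIndepFun h𝔴le hA hY1 hAY1 hAint hY1int hAY1int
  set w : Ω → ℝ := fun ω ↦ ((P[A | 𝔴]) ω)⁻¹ with hw
  have hwmeas : Measurable[𝔴] w := stronglyMeasurable_condExp.measurable.inv
  have hwbound : ∀ᵐ ω ∂P, ‖w ω‖ ≤ cA⁻¹ := by
    filter_upwards [he, hepos] with ω heω hposω
    rw [heω] at hposω
    rw [hw, norm_inv, Real.norm_of_nonneg (hcA.le.trans hposω.1)]
    exact inv_anti₀ hcA hposω.1
  have hAwbound : ∀ᵐ ω ∂P, ‖A ω * w ω‖ ≤ cA⁻¹ := by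
    filter_upwards [hwbound] with ω hω
    rw [norm_mul]
    exact (mul_le_of_le_one_left (norm_nonneg _) (hAbound ω)).trans hω
  calc ∫ ω, (A ω / e ω) * ((P[fun ω' => Δ ω' * Y ω' | 𝔪]) ω / gΔ ω) ∂P
      = ∫ ω, (A ω * w ω) * (P[Y | 𝔪]) ω ∂P := by
        refine integral_congr_ae ?_
        filter_upwards [he, hgΔ, hgΔpos, hMARmul] with ω heω hgω hposω hmulω
        rw [hmulω, ← hgω, mul_div_cancel_left₀ _ (hcΔ.trans_le hposω).ne', heω, div_eq_mul_inv]
    _ = ∫ ω, (A ω * w ω) * Y ω ∂P :=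
        integral_mul_condExp_of_bound h𝔪le
          (hA𝔪.mul (hwmeas.mono h𝔴𝔪 le_rfl)).stronglyMeasurable hYint _ hAwbound
    _ = ∫ ω, w ω * (A ω * Y1 ω) ∂P := by
        refine integral_congr_ae (ae_of_all _ fun ω ↦ ?_)
        rcases hA01 ω with h | h <;> simp [hcons ω, h]
    _ = ∫ ω, w ω * (P[fun ω ↦ A ω * Y1 ω | 𝔴]) ω ∂P :=
        (integral_mul_condExp_of_bound h𝔴le hwmeas.stronglyMeasurable hAY1int _ hwbound).symm
    _ = ∫ ω, (P[Y1 | 𝔴]) ω ∂P := by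
        refine integral_congr_ae ?_
        filter_upwards [he, hepos, hignmul] with ω heω hposω hmulω
        rw [hmulω, hw, inv_mul_cancel_left₀]
        rw [← heω]
        exact (hcA.trans_le hposω.1).ne'
    _ = ∫ ω, Y1 ω ∂P := integral_condExp h𝔴le
end

section
/- Nested identification of the average treatment effect (Theorem 1): under consistency, ignorability, surrogate-mediated MAR, treatment positivity, and censoring support positivity, E[(A / e) · Q̄ − ((1 − A) / (1 − e)) · Q̄] = E[Y(1) − Y(0)]. -/
open MeasureTheory ProbabilityTheory

/-- Conditional expectations of conditionally independent real random variables multiply. -/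
theorem ProbabilityTheory.CondIndepFun.condExp_mul
    {Ω : Type*} {m mΩ : MeasurableSpace Ω} [StandardBorelSpace Ω]
    {μ : Measure Ω} [IsFiniteMeasure μ] {hm : m ≤ mΩ} {f g : Ω → ℝ}
    (h : CondIndepFun m hm f g μ) (hf : Measurable f) (hg : Measurable g)
    (hfint : Integrable f μ) (hgint : Integrable g μ) (hfgint : Integrable (f * g) μ) :
    μ[f * g | m] =ᵐ[μ] μ[f | m] * μ[g | m] := by
  have hker := ae_of_ae_trim hm ((condIndepFun_iff_map_prod_eq_prod_map_map hf hg).1 h)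
  filter_upwards [hker, condExp_ae_eq_integral_condExpKernel hm hfint,
    condExp_ae_eq_integral_condExpKernel hm hgint,
    condExp_ae_eq_integral_condExpKernel hm hfgint] with ω hω hfω hgω hfgω
  have hindep : IndepFun f g (condExpKernel μ m ω) := by
    rw [indepFun_iff_map_prod_eq_prod_map_map hf.aemeasurable hg.aemeasurable]
    rwa [Kernel.map_apply _ (hf.prodMk hg), Kernel.prod_apply, Kernel.map_apply _ hf,
      Kernel.map_apply _ hg] at hω
  rw [Pi.mul_apply, hfω, hgω, hfgω]
  exact hindep.integral_mul_eq_mul_integral hf.aestronglyMeasurable hg.aestronglyMeasurable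

/-- Inverse probability weighting of an outcome regression `Q` recovers the mean of the
counterfactual `T` that is observed whenever the weight `B` is nonzero. -/
theorem integral_div_condExp_mul_condExp
    {Ω : Type*} {m w mΩ : MeasurableSpace Ω} [StandardBorelSpace Ω]
    {μ : Measure Ω} [IsFiniteMeasure μ] (hwm : w ≤ m) (hm : m ≤ mΩ) (hw : w ≤ mΩ)
    {B T Y Q b : Ω → ℝ} {c C : ℝ} (hc : 0 < c)
    (hB : StronglyMeasurable[m] B) (hBC : ∀ ω, ‖B ω‖ ≤ C) (hT : Measurable T)
    (hindep : CondIndepFun w hw B T μ) (hTint : Integrable T μ) (hYint : Integrable Y μ)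
    (hBY : ∀ ω, B ω * Y ω = B ω * T ω)
    (hb : b =ᵐ[μ] μ[B | w]) (hcb : ∀ᵐ ω ∂μ, c ≤ b ω) (hQ : Q =ᵐ[μ] μ[Y | m]) :
    Integrable (fun ω => B ω / b ω * Q ω) μ ∧ ∫ ω, B ω / b ω * Q ω ∂μ = ∫ ω, T ω ∂μ := by
  have hBΩ : StronglyMeasurable B := hB.mono hm
  have hBint : Integrable B μ := .of_bound hBΩ.aestronglyMeasurable C (ae_of_all _ hBC)
  have hBT : Integrable (B * T) μ := hTint.bdd_mul hBΩ.aestronglyMeasurable (ae_of_all _ hBC)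
  set r : Ω → ℝ := fun ω => (μ[B | w] ω)⁻¹ with hr
  have hrw : StronglyMeasurable[w] r :=
    (stronglyMeasurable_condExp.measurable.inv).stronglyMeasurable
  have hrbound : ∀ᵐ ω ∂μ, ‖r ω‖ ≤ c⁻¹ := by
    filter_upwards [hb, hcb] with ω h1 h2
    rw [h1] at h2
    rw [hr, norm_inv, Real.norm_of_nonneg (hc.le.trans h2)]
    exact inv_anti₀ hc h2
  have hrBT : Integrable (r * (B * T)) μ :=
    hBT.bdd_mul (hrw.mono hw).aestronglyMeasurable hrbound
  have hXY : r * B * Y = r * (B * T) := by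
    ext ω
    simp only [Pi.mul_apply, mul_assoc, hBY]
  have hweight : (fun ω => B ω / b ω * Q ω) =ᵐ[μ] μ[r * B * Y | m] := by
    filter_upwards [hb, hQ, condExp_mul_of_stronglyMeasurable_left ((hrw.mono hwm).mul hB)
      (hXY ▸ hrBT) hYint] with ω h1 h2 h3
    rw [h3, h1, h2, Pi.mul_apply, Pi.mul_apply, hr, div_eq_inv_mul]
  have hregress : μ[r * (B * T) | w] =ᵐ[μ] μ[T | w] := by
    filter_upwards [condExp_mul_of_stronglyMeasurable_left hrw hrBT hBT,
      hindep.condExp_mul hBΩ.measurable hT hBint hTint hBT, hb, hcb] with ω h1 h2 h3 h4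
    rw [h3] at h4
    rw [h1, Pi.mul_apply, h2, Pi.mul_apply, hr, inv_mul_cancel_left₀ (hc.trans_le h4).ne']
  refine ⟨integrable_condExp.congr hweight.symm, ?_⟩
  rw [integral_congr_ae hweight, integral_condExp hm, hXY, ← integral_condExp hw,
    integral_congr_ae hregress, integral_condExp hw]

/-- **Nested identification of the average treatment effect** (Theorem 1).  With
`𝔪 := σ(S, A, W)`, `𝔴 := σ(W)`, `gΔ` a version of `E[Δ | 𝔪]`, `e` a version of
`E[A | 𝔴]`, and the observed-data outcome regression `Q̄ := E[Δ·Y | 𝔪] / gΔ`, under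
consistency, ignorability, surrogate-mediated MAR, treatment positivity and censoring
support positivity one has
`E[(A / e) · Q̄ − ((1 − A) / (1 − e)) · Q̄] = E[Y(1) − Y(0)]`. -/
theorem nested_identification_ATE
    {Ω : Type*} [mΩ : MeasurableSpace Ω] [StandardBorelSpace Ω]
    {P : Measure Ω} [IsProbabilityMeasure P] {p : ℕ}
    (W : Ω → (Fin p → ℝ)) (A S Δ Y Y0 Y1 : Ω → ℝ)
    (hW : Measurable W) (hA : Measurable A) (hS : Measurable S)
    (hΔ : Measurable Δ) (hY : Measurable Y)
    (hY0 : Measurable Y0) (hY1 : Measurable Y1)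
    (hA01 : ∀ ω, A ω = 0 ∨ A ω = 1) (hΔ01 : ∀ ω, Δ ω = 0 ∨ Δ ω = 1)
    (𝔪 𝔴 : MeasurableSpace Ω)
    (h𝔪 : 𝔪 = MeasurableSpace.comap (fun ω => (S ω, A ω, W ω)) inferInstance)
    (h𝔴 : 𝔴 = MeasurableSpace.comap W inferInstance)
    (h𝔪le : 𝔪 ≤ mΩ) (h𝔴le : 𝔴 ≤ mΩ)
    -- consistency
    (hcons : ∀ ω, Y ω = A ω * Y1 ω + (1 - A ω) * Y0 ω)
    -- ignorability
    (hign : CondIndepFun 𝔴 h𝔴le A (fun ω => (Y0 ω, Y1 ω)) P)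
    -- surrogate-mediated MAR
    (hMAR : CondIndepFun 𝔪 h𝔪le Δ Y P)
    (hY0int : Integrable Y0 P) (hY1int : Integrable Y1 P) (hYint : Integrable Y P)
    (gΔ : Ω → ℝ) (hgΔ : gΔ =ᵐ[P] P[Δ | 𝔪])
    (e : Ω → ℝ) (he : e =ᵐ[P] P[A | 𝔴])
    -- treatment positivity
    (cA : ℝ) (hcA : 0 < cA) (hepos : ∀ᵐ ω ∂P, cA ≤ e ω ∧ e ω ≤ 1 - cA)
    -- censoring support positivity
    (cΔ : ℝ) (hcΔ : 0 < cΔ) (hgΔpos : ∀ᵐ ω ∂P, cΔ ≤ gΔ ω) :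
    ∫ ω, (A ω / e ω) * ((P[fun ω' => Δ ω' * Y ω' | 𝔪]) ω / gΔ ω)
        - ((1 - A ω) / (1 - e ω)) * ((P[fun ω' => Δ ω' * Y ω' | 𝔪]) ω / gΔ ω) ∂P
      = ∫ ω, Y1 ω - Y0 ω ∂P := by
  have hAnorm : ∀ ω, ‖A ω‖ ≤ 1 := fun ω => by rcases hA01 ω with h | h <;> simp [h]
  have hAcnorm : ∀ ω, ‖1 - A ω‖ ≤ 1 := fun ω => by rcases hA01 ω with h | h <;> simp [h]
  have hΔnorm : ∀ ω, ‖Δ ω‖ ≤ 1 := fun ω => by rcases hΔ01 ω with h | h <;> simp [h]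
  have hAint : Integrable A P :=
    .of_bound hA.aestronglyMeasurable 1 (ae_of_all _ hAnorm)
  have hΔint : Integrable Δ P :=
    .of_bound hΔ.aestronglyMeasurable 1 (ae_of_all _ hΔnorm)
  have hSAW : Measurable[𝔪] fun ω => (S ω, A ω, W ω) := by
    rw [h𝔪]
    exact comap_measurable _
  have hA𝔪 : Measurable[𝔪] A := measurable_fst.comp (measurable_snd.comp hSAW)
  have hW𝔪 : Measurable[𝔪] W := measurable_snd.comp (measurable_snd.comp hSAW)
  have h𝔴𝔪 : 𝔴 ≤ 𝔪 := h𝔴 ▸ hW𝔪.comap_le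
  have hQ : (fun ω => (P[fun ω' => Δ ω' * Y ω' | 𝔪]) ω / gΔ ω) =ᵐ[P] P[Y | 𝔪] := by
    filter_upwards [hMAR.condExp_mul hΔ hY hΔint hYint
      (hYint.bdd_mul hΔ.aestronglyMeasurable (ae_of_all _ hΔnorm)), hgΔ, hgΔpos] with ω h1 h2 h3
    change (P[Δ * Y | 𝔪]) ω / gΔ ω = _
    rw [h1, Pi.mul_apply, ← h2, mul_div_cancel_left₀ _ (hcΔ.trans_le h3).ne']
  have hec : (fun ω => 1 - e ω) =ᵐ[P] P[fun ω => 1 - A ω | 𝔴] := by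
    filter_upwards [he, condExp_sub (integrable_const (1 : ℝ)) hAint 𝔴] with ω h1 h2
    change _ = (P[(fun _ => (1 : ℝ)) - A | 𝔴]) ω
    rw [h2, Pi.sub_apply, condExp_const h𝔴le, h1]
  obtain ⟨hint1, heq1⟩ := integral_div_condExp_mul_condExp h𝔴𝔪 h𝔪le h𝔴le hcA
    hA𝔪.stronglyMeasurable hAnorm hY1 (hign.comp measurable_id measurable_snd) hY1int hYint
    (fun ω => by rcases hA01 ω with h | h <;> simp [hcons, h]) he (hepos.mono fun _ h => h.1) hQ
  obtain ⟨hint0, heq0⟩ := integral_div_condExp_mul_condExp (B := fun ω => 1 - A ω)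
    h𝔴𝔪 h𝔪le h𝔴le hcA
    (hA𝔪.const_sub 1).stronglyMeasurable hAcnorm hY0
    (hign.comp (measurable_id.const_sub 1) measurable_fst) hY0int hYint
    (fun ω => by rcases hA01 ω with h | h <;> simp [hcons, h]) hec
    (hepos.mono fun _ h => by linarith [h.2]) hQ
  rw [integral_sub hint1 hint0, heq1, heq0, integral_sub hY1int hY0int]
end
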